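/- There exist r > 0 and C > 0, depending only on f, such that for all s with |s| ≤ r and all y ∈ B_r(0), writing x = (s, f(s)), one has ||x − y*(y)|² − |x − y|²| ≤ C|x − y|³. -/

import Mathlib

open Real

noncomputable section

/-- The point `(a, b)` of the Euclidean plane. -/
def pt (a b : ℝ) : EuclideanSpace ℝ (Fin 2) := (WithLp.equiv 2 (Fin 2 → ℝ)).symm ![a, b]

@[simp]
lemma pt_apply_zero (a b : ℝ) : pt a b 0 = a := rfl

@[simp]
lemma pt_apply_one (a b : ℝ) : pt a b 1 = b := rfl

lemma continuous_pt {f : ℝ → ℝ} (hf : Continuous f) : Continuous fun s => pt s (f s) := by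
  refine (PiLp.continuous_toLp 2 (fun _ : Fin 2 => ℝ)).comp (continuous_pi fun i => ?_)
  fin_cases i
  · exact continuous_id
  · exact hf

/-- A first-order Taylor estimate for a function whose derivative is Lipschitz on a convex set. -/
lemma abs_sub_sub_deriv_mul_le {f : ℝ → ℝ} (hf : Differentiable ℝ f) {I : Set ℝ}
    (hI : Convex ℝ I) {M : NNReal} (hM : LipschitzOnWith M (deriv f) I) {s t : ℝ}
    (hs : s ∈ I) (ht : t ∈ I) :
    |f s - f t - deriv f t * (s - t)| ≤ M * |s - t| ^ 2 := by
  have hg : ∀ u, HasDerivAt (fun u => f u - deriv f t * u) (deriv f u - deriv f t) u := fun u => by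
    have h := (hf u).hasDerivAt.sub ((hasDerivAt_id' u).const_mul (deriv f t))
    rwa [mul_one] at h
  have hsub : Set.uIcc t s ⊆ I := by
    rw [← segment_eq_uIcc]
    exact hI.segment_subset ht hs
  have key := Convex.norm_image_sub_le_of_norm_hasDerivWithin_le (C := M * |s - t|)
    (fun u _ => (hg u).hasDerivWithinAt) (fun u hu => ?_) (convex_uIcc t s)
    Set.left_mem_uIcc Set.right_mem_uIcc
  · rw [Real.norm_eq_abs, Real.norm_eq_abs] at key
    calc |f s - f t - deriv f t * (s - t)|
        = |f s - deriv f t * s - (f t - deriv f t * t)| := by congr 1; ring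
      _ ≤ M * |s - t| * |s - t| := key
      _ = M * |s - t| ^ 2 := by ring
  · have h := hM.dist_le_mul u (hsub hu) t ht
    rw [Real.dist_eq, Real.dist_eq] at h
    exact h.trans (mul_le_mul_of_nonneg_left (Set.abs_sub_left_of_mem_uIcc hu) M.2)

/-- The squared distances from `x` to `y` and to its reflection in `e` differ by
`4 ⟨x - e, y - e⟩`. -/
lemma norm_sub_reflection_sq_sub_norm_sub_sq (x y e : EuclideanSpace ℝ (Fin 2)) :
    ‖x - ((2 : ℝ) • e - y)‖ ^ 2 - ‖x - y‖ ^ 2 =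
      4 * ((x 0 - e 0) * (y 0 - e 0) + (x 1 - e 1) * (y 1 - e 1)) := by
  simp only [EuclideanSpace.real_norm_sq_eq, Fin.sum_univ_two, PiLp.sub_apply, PiLp.smul_apply,
    smul_eq_mul]
  ring

/-- **Distance comparison for the reflected point.**
With `f`, the implicit map `S` of Lemma 1 (on a ball of radius `r₀`) and the
reflection `y*(y) = 2 (S y, f (S y)) − y`: there exist `r > 0` and `C > 0`,
depending only on `f`, such that for all `s` with `|s| ≤ r` and all
`y ∈ B_r(0)`, writing `x = (s, f s)`,
`| |x − y*(y)|² − |x − y|² | ≤ C |x − y|³`. -/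
theorem reflection_distance_squared_comparison
    (f : ℝ → ℝ) (hf : ContDiff ℝ 3 f) (hf0 : f 0 = 0) (hf'0 : deriv f 0 = 0)
    (r₀ : ℝ) (hr₀ : 0 < r₀) (S : EuclideanSpace ℝ (Fin 2) → ℝ)
    (hS : ∀ y ∈ Metric.ball (0 : EuclideanSpace ℝ (Fin 2)) r₀,
        S y ∈ Set.Ioo (-(2 * r₀)) (2 * r₀) ∧
        (S y - y 0) + deriv f (S y) * (f (S y) - y 1) = 0 ∧
        ∀ s ∈ Set.Ioo (-(2 * r₀)) (2 * r₀),
          (s - y 0) + deriv f s * (f s - y 1) = 0 → s = S y)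
    (hS2 : ContDiffOn ℝ 2 S (Metric.ball 0 r₀))
    (ystar : EuclideanSpace ℝ (Fin 2) → EuclideanSpace ℝ (Fin 2))
    (hystar : ∀ y, ystar y = (2 : ℝ) • pt (S y) (f (S y)) - y) :
    ∃ r C : ℝ, 0 < r ∧ r ≤ r₀ ∧ 0 < C ∧
      ∀ s : ℝ, |s| ≤ r →
        ∀ y ∈ Metric.ball (0 : EuclideanSpace ℝ (Fin 2)) r,
          |‖pt s (f s) - ystar y‖ ^ 2 - ‖pt s (f s) - y‖ ^ 2|
            ≤ C * ‖pt s (f s) - y‖ ^ 3 := by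
  have hfd : Differentiable ℝ f := hf.differentiable (by norm_num)
  have hf' : ContDiff ℝ 1 (deriv f) := (hf.of_le (by norm_num : (1 : WithTop ℕ∞) + 1 ≤ 3)).deriv'
  set I : Set ℝ := Set.Icc (-(2 * r₀)) (2 * r₀)
  obtain ⟨K, hK⟩ := (hf.of_le (by norm_num : (1 : WithTop ℕ∞) ≤ 3)).locallyLipschitz
    |>.locallyLipschitzOn (s := I) |>.exists_lipschitzOnWith_of_compact isCompact_Icc
  obtain ⟨M, hM⟩ := hf'.locallyLipschitz.locallyLipschitzOn (s := I)
    |>.exists_lipschitzOnWith_of_compact isCompact_Icc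
  have hball : Metric.ball (0 : EuclideanSpace ℝ (Fin 2)) r₀ ∈ nhds 0 :=
    Metric.ball_mem_nhds _ hr₀
  obtain ⟨L, t, ht, hL⟩ :=
    ((hS2.contDiffAt hball).of_le (by norm_num : (1 : WithTop ℕ∞) ≤ 2)).exists_lipschitzOnWith
  have hpt0 : pt 0 (f 0) = 0 := by
    ext i
    fin_cases i
    · rfl
    · exact hf0
  have hpre : ∀ᶠ s in nhds (0 : ℝ), pt s (f s) ∈ t ∩ Metric.ball 0 r₀ := by
    refine (continuous_pt hf.continuous).continuousAt.eventually_mem ?_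
    rw [hpt0]
    exact Filter.inter_mem ht hball
  obtain ⟨r₁, hr₁, h₁⟩ := Metric.eventually_nhds_iff.1 hpre
  obtain ⟨r₂, hr₂, h₂⟩ := Metric.mem_nhds_iff.1 ht
  refine ⟨min (r₁ / 2) (min r₂ r₀), 4 * ((1 + K * L) * (M * L ^ 2)) + 1,
    by positivity, (min_le_right _ _).trans (min_le_right _ _), by positivity, ?_⟩
  intro s hs y hy
  obtain ⟨hs₁, -, hs₀⟩ : |s| ≤ r₁ / 2 ∧ |s| ≤ r₂ ∧ |s| ≤ r₀ := by simpa using hs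
  have hy' : ‖y‖ < min (r₁ / 2) (min r₂ r₀) := by simpa using hy
  obtain ⟨-, hy₂, hy₀⟩ : ‖y‖ < r₁ / 2 ∧ ‖y‖ < r₂ ∧ ‖y‖ < r₀ := by simpa using hy'
  have hyt : y ∈ t := h₂ (by simpa using hy₂)
  obtain ⟨hσI, hσ, -⟩ := hS y (by simpa using hy₀)
  obtain ⟨hxt, hxb⟩ := h₁ (y := s) (by rw [Real.dist_eq, sub_zero]; linarith)
  have hsI : s ∈ Set.Ioo (-(2 * r₀)) (2 * r₀) := abs_lt.1 (by linarith)
  have hSx : s = S (pt s (f s)) := (hS _ hxb).2.2 s hsI (by simp)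
  have hLs : |s - S y| ≤ L * ‖pt s (f s) - y‖ := by
    have h := hL.dist_le_mul _ hxt y hyt
    rwa [← hSx, Real.dist_eq, dist_eq_norm] at h
  have hKs : |f s - f (S y)| ≤ K * |s - S y| :=
    hK.dist_le_mul s (Set.Ioo_subset_Icc_self hsI) _ (Set.Ioo_subset_Icc_self hσI)
  have hTs := abs_sub_sub_deriv_mul_le hfd (convex_Icc _ _) hM
    (Set.Ioo_subset_Icc_self hsI) (Set.Ioo_subset_Icc_self hσI)
  have hcoord : |f s - y 1| ≤ ‖pt s (f s) - y‖ := PiLp.norm_apply_le (pt s (f s) - y) 1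
  rw [hystar, norm_sub_reflection_sq_sub_norm_sub_sq]
  simp only [pt_apply_zero, pt_apply_one]
  set D := ‖pt s (f s) - y‖
  have hD : 0 ≤ D := norm_nonneg _
  have hd : |y 1 - f (S y)| ≤ (1 + K * L) * D :=
    calc |y 1 - f (S y)| ≤ |y 1 - f s| + |f s - f (S y)| := abs_sub_le _ _ _
      _ ≤ D + K * (L * D) := by
        rw [abs_sub_comm (y 1)]
        gcongr
        exact hKs.trans (by gcongr)
      _ = (1 + K * L) * D := by ring
  have hortho : y 0 - S y = -(deriv f (S y) * (y 1 - f (S y))) := by linear_combination -hσ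
  rw [hortho]
  calc |4 * ((s - S y) * -(deriv f (S y) * (y 1 - f (S y)))
          + (f s - f (S y)) * (y 1 - f (S y)))|
      = 4 * (|y 1 - f (S y)| * |f s - f (S y) - deriv f (S y) * (s - S y)|) := by
        rw [← abs_mul, ← abs_of_pos (four_pos (α := ℝ)), ← abs_mul, abs_of_pos (four_pos (α := ℝ))]
        congr 1
        ring
    _ ≤ 4 * ((1 + K * L) * D * (M * (L * D) ^ 2)) := by
        gcongr
        exact hTs.trans (by gcongr)
    _ = 4 * ((1 + K * L) * (M * L ^ 2)) * D ^ 3 := by ring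
    _ ≤ (4 * ((1 + K * L) * (M * L ^ 2)) + 1) * D ^ 3 := by
        gcongr
        linarith
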